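/- Consider the linear map T: ℂ² → ℂ² defined on the basis by T(w, w) = (w, w) and T(w, −w) = ( ((1 + e^{iφ₁} − 2e^{iθ})/(e^{iφ₁} − 1))·w , ((1 + e^{iφ₁} − 2e^{i(θ+φ₂)})/(e^{iφ₁} − 1))·w ) for all w ∈ ℂ, where 0 < θ < φ₁ ≤ π and φ₁ < φ₂ + θ < 2π. Then for any nonzero u ∈ ℂ, (ℝu ⊕ ℝu) ∩ T(ℝu ⊕ ℝu) = ℝ·(u, u). -/

import Mathlib

open Complex Real

/-- The real-linear (indeed complex-linear) map `T : ℂ² → ℂ²` determined by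
`T(w,w) = (w,w)` and `T(w,-w) = (α·w, β·w)` with
`α = (1 + e^{iφ₁} − 2e^{iθ})/(e^{iφ₁} − 1)` and
`β = (1 + e^{iφ₁} − 2e^{i(θ+φ₂)})/(e^{iφ₁} − 1)`. -/
noncomputable def Tmap (θ φ₁ φ₂ : ℝ) (p : ℂ × ℂ) : ℂ × ℂ :=
  let α : ℂ := (1 + Complex.exp (φ₁ * Complex.I) - 2 * Complex.exp (θ * Complex.I)) /
      (Complex.exp (φ₁ * Complex.I) - 1)
  let β : ℂ := (1 + Complex.exp (φ₁ * Complex.I) -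
      2 * Complex.exp ((θ + φ₂) * Complex.I)) / (Complex.exp (φ₁ * Complex.I) - 1)
  ((p.1 + p.2) / 2 + α * ((p.1 - p.2) / 2), (p.1 + p.2) / 2 + β * ((p.1 - p.2) / 2))

/-- The sine is strictly subadditive on `(0, π)`. -/
theorem sin_add_lt_sin_add_sin {a b : ℝ} (ha : 0 < a) (ha' : a < π) (hb : 0 < b) (hb' : b < π) :
    Real.sin (a + b) < Real.sin a + Real.sin b := by
  have hsa := Real.sin_pos_of_pos_of_lt_pi ha ha'
  have hsb := Real.sin_pos_of_pos_of_lt_pi hb hb'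
  have hca : Real.cos a < 1 := by
    nlinarith [Real.sin_sq_add_cos_sq a, Real.cos_le_one a]
  have hcb : Real.cos b < 1 := by
    nlinarith [Real.sin_sq_add_cos_sq b, Real.cos_le_one b]
  rw [Real.sin_add]
  nlinarith [mul_pos hsa (sub_pos.2 hcb), mul_pos hsb (sub_pos.2 hca)]

theorem exp_mul_I_ne_one {φ : ℝ} (h0 : 0 < φ) (h1 : φ ≤ π) :
    Complex.exp (φ * Complex.I) ≠ 1 := by
  intro h
  have hre := congrArg Complex.re h
  rw [Complex.exp_ofReal_mul_I_re, Complex.one_re] at hre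
  have hlt := Real.cos_lt_cos_of_nonneg_of_le_pi le_rfl h1 h0
  rw [Real.cos_zero] at hlt
  exact hlt.ne hre

/-- A point strictly inside a circular arc is not on the line through its endpoints. -/
theorem chord_coefficient_ne_ofReal {θ φ : ℝ} (h1 : 0 < θ) (h2 : θ < φ) (h3 : φ ≤ π) (r : ℝ) :
    (1 + Complex.exp (φ * Complex.I) - 2 * Complex.exp (θ * Complex.I)) /
      (Complex.exp (φ * Complex.I) - 1) ≠ r := by
  intro h
  rw [div_eq_iff (sub_ne_zero.2 (exp_mul_I_ne_one (h1.trans h2) h3))] at h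
  have hre := congrArg Complex.re h
  have him := congrArg Complex.im h
  simp [Complex.exp_ofReal_mul_I_re, Complex.exp_ofReal_mul_I_im] at hre him
  have hlt := sin_add_lt_sin_add_sin h1 (by linarith) (sub_pos.2 h2) (by linarith)
  rw [add_sub_cancel, Real.sin_sub] at hlt
  apply hlt.ne
  linear_combination (Real.sin φ / 2) * hre - ((Real.cos φ - 1) / 2) * him

/-- For `0 < θ < φ₁ ≤ π`, `φ₁ < φ₂ + θ < 2π`, and any nonzero `u ∈ ℂ`, the
intersection of the real plane `ℝu ⊕ ℝu ⊂ ℂ²` with its image under `T` is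
exactly the diagonal real line `ℝ·(u,u)`. -/
theorem stmt4 (θ φ₁ φ₂ : ℝ) (h1 : 0 < θ) (h2 : θ < φ₁) (h3 : φ₁ ≤ π)
    (h4 : φ₁ < φ₂ + θ) (h5 : φ₂ + θ < 2 * π) (u : ℂ) (hu : u ≠ 0) :
    {p : ℂ × ℂ | ∃ s t : ℝ, p = ((s : ℂ) * u, (t : ℂ) * u)} ∩
      (Tmap θ φ₁ φ₂ '' {p : ℂ × ℂ | ∃ s t : ℝ, p = ((s : ℂ) * u, (t : ℂ) * u)}) =
      {p : ℂ × ℂ | ∃ s : ℝ, p = ((s : ℂ) * u, (s : ℂ) * u)} := by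
  ext p
  constructor
  · rintro ⟨⟨a, b, rfl⟩, q, ⟨s, t, rfl⟩, hT⟩
    simp only [Tmap, Prod.mk.injEq] at hT
    obtain ⟨ha, hb⟩ := hT
    have hst : s = t := by
      by_contra hne
      have hd : (s : ℂ) - t ≠ 0 := sub_ne_zero.2 (by exact_mod_cast hne)
      apply chord_coefficient_ne_ofReal h1 h2 h3 ((2 * a - (s + t)) / (s - t))
      push_cast
      rw [eq_div_iff hd]
      apply mul_right_cancel₀ hu
      linear_combination 2 * ha
    subst hst
    refine ⟨b, ?_⟩
    rw [Prod.mk.injEq]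
    refine ⟨?_, rfl⟩
    rw [← ha, ← hb]
    ring
  · rintro ⟨s, rfl⟩
    refine ⟨⟨s, s, rfl⟩, _, ⟨s, s, rfl⟩, ?_⟩
    simp [Tmap]
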